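/- Let m be a positive integer and let θ ∈ (0,1) satisfy φ_{m−1}² ≤ θ ≤ φ_m² (with the convention φ_0 = 0). Then for every positive integer m′, L_m(θ) ≤ L_{m′}(θ); that is, m is the optimal value of the coding parameter for scale parameter θ in the asymptotic precision limit. -/

import Mathlib

open Classical in
/-- Asymptotic average code-length `L_m(θ)` of the modified Rice–Golomb code. -/
noncomputable def asympLen (m : ℕ) (θ : ℝ) : ℝ :=
  if ∃ β : ℕ, m = 2 ^ β then
    1 + Real.logb 2 m + θ ^ ((m : ℝ)/2) / (1 - θ ^ ((m : ℝ)/2))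
  else
    1 + (Nat.log 2 m : ℝ) +
      θ ^ (((2 ^ Nat.clog 2 m - m : ℕ) : ℝ)/2) / (1 - θ ^ ((m : ℝ)/2))

lemma sq_rpow_half {x : ℝ} (hx : 0 ≤ x) (n : ℕ) : (x ^ 2) ^ ((n : ℝ) / 2) = x ^ n := by
  rw [← Real.rpow_natCast x 2, ← Real.rpow_mul hx, ← Real.rpow_natCast x n]
  congr 1
  push_cast
  ring

lemma asympLen_sq {x : ℝ} (hx : 0 ≤ x) {m : ℕ} (hm : 0 < m) :
    asympLen m (x ^ 2) =
      1 + (Nat.log 2 m : ℝ) + x ^ (2 ^ (Nat.log 2 m + 1) - m) / (1 - x ^ m) := by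
  unfold asympLen
  split_ifs with h
  · obtain ⟨β, rfl⟩ := h
    have hlog : Nat.log 2 (2 ^ β) = β := Nat.log_pow (by norm_num) β
    have hsub : 2 ^ (β + 1) - 2 ^ β = 2 ^ β := by
      rw [pow_succ]
      omega
    rw [sq_rpow_half hx, hlog, hsub]
    congr 2
    push_cast
    rw [← Real.rpow_natCast 2 β, Real.logb_rpow (by norm_num) (by norm_num)]
  · have hclog : Nat.clog 2 m = Nat.log 2 m + 1 := by
      apply le_antisymm
      · exact Nat.clog_le_of_le_pow (Nat.lt_pow_succ_log_self (by norm_num) m).le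
      · rw [Nat.succ_le_iff, Nat.lt_clog_iff_pow_lt (by norm_num)]
        exact lt_of_le_of_ne (Nat.pow_log_le_self 2 hm.ne') fun e => h ⟨_, e.symm⟩
    rw [sq_rpow_half hx, sq_rpow_half hx, hclog]

/-- Consecutive code-lengths differ by a positive multiple of `1 - x ^ m - x ^ (m + 1)`,
where `x = √θ`. -/
lemma exists_asympLen_succ_sub {x : ℝ} (hx : x ∈ Set.Ioo (0 : ℝ) 1) {m : ℕ} (hm : 0 < m) :
    ∃ c : ℝ, 0 < c ∧
      asympLen (m + 1) (x ^ 2) - asympLen m (x ^ 2) = c * (1 - x ^ m - x ^ (m + 1)) := by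
  obtain ⟨hx0, hx1⟩ := hx
  have hden : 0 < 1 - x ^ m := sub_pos.2 (pow_lt_one₀ hx0.le hx1 hm.ne')
  have hden' : 0 < 1 - x ^ (m + 1) := sub_pos.2 (pow_lt_one₀ hx0.le hx1 (by omega))
  have hlow : 2 ^ Nat.log 2 m ≤ m := Nat.pow_log_le_self 2 hm.ne'
  have hupp : m < 2 ^ (Nat.log 2 m + 1) := Nat.lt_pow_succ_log_self (by norm_num) m
  obtain ⟨d, hd⟩ : ∃ d, 2 ^ (Nat.log 2 m + 1) = m + 1 + d := Nat.exists_eq_add_of_le hupp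
  have hm_len : asympLen m (x ^ 2) =
      1 + (Nat.log 2 m : ℝ) + x ^ (d + 1) / (1 - x ^ m) := by
    rw [asympLen_sq hx0.le hm, hd, show m + 1 + d - m = d + 1 by omega]
  have hsucc_len : asympLen (m + 1) (x ^ 2) =
      1 + (Nat.log 2 m : ℝ) + x ^ d / (1 - x ^ (m + 1)) := by
    rw [asympLen_sq hx0.le m.succ_pos]
    rcases Nat.eq_zero_or_pos d with rfl | hdpos
    · have hlog : Nat.log 2 (m + 1) = Nat.log 2 m + 1 := by
        rw [show m + 1 = 2 ^ (Nat.log 2 m + 1) by omega, Nat.log_pow (by norm_num)]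
      have hsub : 2 ^ (Nat.log 2 m + 1 + 1) - (m + 1) = m + 1 := by
        rw [pow_succ, hd]
        omega
      rw [hlog, hsub]
      push_cast
      field_simp
      ring
    · have hlog : Nat.log 2 (m + 1) = Nat.log 2 m :=
        Nat.log_eq_of_pow_le_of_lt_pow (by omega) (by omega)
      rw [hlog, hd, Nat.add_sub_cancel_left]
  refine ⟨x ^ d * (1 - x) / ((1 - x ^ m) * (1 - x ^ (m + 1))), ?_, ?_⟩
  · have := sub_pos.2 hx1
    positivity
  · rw [hm_len, hsucc_len]
    field_simp
    ring

/-- if `φ_{m-1}² ≤ θ ≤ φ_m²` (with `φ_0 = 0`), then `m` is the optimal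
coding parameter for scale `θ` in the asymptotic precision limit. -/
theorem optimal_m (m : ℕ) (hm : 0 < m) (θ φprev φcur : ℝ)
    (hθ : θ ∈ Set.Ioo (0:ℝ) 1)
    (hprev0 : m = 1 → φprev = 0)
    (hprev : 2 ≤ m → φprev ∈ Set.Ioo (0:ℝ) 1 ∧ φprev ^ m + φprev ^ (m - 1) - 1 = 0)
    (hcur : φcur ∈ Set.Ioo (0:ℝ) 1 ∧ φcur ^ (m + 1) + φcur ^ m - 1 = 0)
    (hlo : φprev ^ 2 ≤ θ) (hhi : θ ≤ φcur ^ 2) :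
    ∀ m' : ℕ, 0 < m' → asympLen m θ ≤ asympLen m' θ := by
  obtain ⟨x, ⟨hx0, hx1⟩, rfl⟩ : ∃ x ∈ Set.Ioo (0 : ℝ) 1, x ^ 2 = θ :=
    ⟨√θ, ⟨Real.sqrt_pos.2 hθ.1, by rw [Real.sqrt_lt' one_pos]; simpa using hθ.2⟩,
      Real.sq_sqrt hθ.1.le⟩
  have hsum_anti : ∀ {i j : ℕ}, i ≤ j → x ^ j + x ^ (j + 1) ≤ x ^ i + x ^ (i + 1) :=
    fun h => add_le_add (pow_le_pow_of_le_one hx0.le hx1.le h)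
      (pow_le_pow_of_le_one hx0.le hx1.le (by omega))
  have hx_cur : x ≤ φcur := le_of_sq_le_sq hhi hcur.1.1.le
  have hup : x ^ m + x ^ (m + 1) ≤ 1 := by
    have h₁ := pow_le_pow_left₀ hx0.le hx_cur m
    have h₂ := pow_le_pow_left₀ hx0.le hx_cur (m + 1)
    linarith [hcur.2]
  intro m' hm'
  rcases le_total m m' with h | h
  · induction m', h using Nat.le_induction with
    | base => exact le_rfl
    | succ j hj ih =>
      obtain ⟨c, hc, hdiff⟩ := exists_asympLen_succ_sub ⟨hx0, hx1⟩ (hm.trans_le hj)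
      have hnonneg : 0 ≤ c * (1 - x ^ j - x ^ (j + 1)) :=
        mul_nonneg hc.le (by linarith [hsum_anti hj])
      linarith [ih (hm.trans_le hj)]
  · induction h using Nat.decreasingInduction with
    | self => exact le_rfl
    | of_succ j hj ih =>
      obtain ⟨hprev_mem, hprev_root⟩ := hprev (by omega)
      have hx_prev : φprev ≤ x := le_of_sq_le_sq hlo hx0.le
      have hdown : 1 ≤ x ^ (m - 1) + x ^ (m - 1 + 1) := by
        have h₁ := pow_le_pow_left₀ hprev_mem.1.le hx_prev (m - 1)
        have h₂ := pow_le_pow_left₀ hprev_mem.1.le hx_prev m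
        rw [Nat.sub_add_cancel hm]
        linarith
      obtain ⟨c, hc, hdiff⟩ := exists_asympLen_succ_sub ⟨hx0, hx1⟩ hm'
      have hnonpos : c * (1 - x ^ j - x ^ (j + 1)) ≤ 0 :=
        mul_nonpos_of_nonneg_of_nonpos hc.le
          (by linarith [hsum_anti (show j ≤ m - 1 by omega)])
      linarith [ih j.succ_pos]
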